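/- Let (G, I, O, λ) be a labelled open graph with a Pauli flow (p, ≺) and let v ∈ V∖O. Then there exists a map p' : V∖O → 𝒫(V∖I) such that: (1) p'(w) = p(w) for every w ∈ V∖O with w ≠ v; (2) p'(v) is focussed over (V∖O)∖{v}; and (3) (p', ≺) is a Pauli flow for (G, I, O, λ). -/

import Mathlib

open scoped symmDiff

inductive MeasLabel : Type
  | XY | XZ | YZ | X | Y | Z
deriving DecidableEq

/-- A labelled open graph: a finite simple graph with input and output sets and a
measurement labelling (only its values on non-outputs are ever used). -/
structure LOG (V : Type) [Fintype V] where
  G : SimpleGraph V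
  I : Set V
  O : Set V
  lam : V → MeasLabel

namespace LOG

variable {V : Type} [Fintype V]

/-- The odd neighbourhood of `A`: vertices with an odd number of neighbours in `A`. -/
def odd (G : SimpleGraph V) (A : Set V) : Set V :=
  {w | Odd ((G.neighborSet w ∩ A).ncard)}

/-- `v` is a measured (non-output) vertex whose label lies in `s`.  (The labelling of a
labelled open graph is only defined on non-outputs.) -/
def labIn (Γ : LOG V) (v : V) (s : Set MeasLabel) : Prop :=
  v ∉ Γ.O ∧ Γ.lam v ∈ s

/-- The Pauli flow conditions for a map `p` and a strict partial order `prec` (`≺`). -/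
structure IsPauliFlow (Γ : LOG V) (p : V → Set V) (prec : V → V → Prop) : Prop where
  irrefl : ∀ a, ¬ prec a a
  trans : ∀ a b c, prec a b → prec b c → prec a c
  psub : ∀ u, u ∉ Γ.O → ∀ v ∈ p u, v ∉ Γ.I
  pf1 : ∀ u, u ∉ Γ.O → ∀ v ∈ p u, u ≠ v →
    ¬ Γ.labIn v {MeasLabel.X, MeasLabel.Y} → prec u v
  pf2 : ∀ u, u ∉ Γ.O → ∀ v ∈ odd Γ.G (p u), u ≠ v →
    ¬ Γ.labIn v {MeasLabel.Y, MeasLabel.Z} → prec u v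
  pf3 : ∀ u, u ∉ Γ.O → ∀ v, ¬ prec u v → u ≠ v →
    Γ.labIn v {MeasLabel.Y} → (v ∈ p u ↔ v ∈ odd Γ.G (p u))
  pf4 : ∀ u, u ∉ Γ.O → Γ.lam u = MeasLabel.XY → u ∉ p u ∧ u ∈ odd Γ.G (p u)
  pf5 : ∀ u, u ∉ Γ.O → Γ.lam u = MeasLabel.XZ → u ∈ p u ∧ u ∈ odd Γ.G (p u)
  pf6 : ∀ u, u ∉ Γ.O → Γ.lam u = MeasLabel.YZ → u ∈ p u ∧ u ∉ odd Γ.G (p u)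
  pf7 : ∀ u, u ∉ Γ.O → Γ.lam u = MeasLabel.X → u ∈ odd Γ.G (p u)
  pf8 : ∀ u, u ∉ Γ.O → Γ.lam u = MeasLabel.Z → u ∈ p u
  pf9 : ∀ u, u ∉ Γ.O → Γ.lam u = MeasLabel.Y →
    ((u ∈ p u ∧ u ∉ odd Γ.G (p u)) ∨ (u ∉ p u ∧ u ∈ odd Γ.G (p u)))

/-- `phat` is focussed over `S`. -/
def FocussedOver (Γ : LOG V) (phat S : Set V) : Prop :=
  (∀ w ∈ S ∩ phat, Γ.lam w ∈ ({MeasLabel.XY, MeasLabel.X, MeasLabel.Y} : Set MeasLabel)) ∧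
  (∀ w ∈ S ∩ odd Γ.G phat,
    Γ.lam w ∈ ({MeasLabel.XZ, MeasLabel.YZ, MeasLabel.Y, MeasLabel.Z} : Set MeasLabel)) ∧
  (∀ w ∈ S, Γ.lam w = MeasLabel.Y → (w ∈ phat ↔ w ∈ odd Γ.G phat))

/-- A focussed set for `Γ`: a subset of the non-inputs that is focussed over all
non-outputs. -/
def IsFocussedSet (Γ : LOG V) (phat : Set V) : Prop :=
  (∀ v ∈ phat, v ∉ Γ.I) ∧ FocussedOver Γ phat {v | v ∉ Γ.O}

/-- A Pauli flow map `p` is focussed if each `p v` is focussed over the measured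
vertices other than `v`. -/
def IsFocussed (Γ : LOG V) (p : V → Set V) : Prop :=
  ∀ v, v ∉ Γ.O → FocussedOver Γ (p v) ({w | w ∉ Γ.O} \ {v})

/-- `Vcum prec k` is `V_{∪k}^≺`, the union of the layers up to depth `k`. -/
def Vcum (prec : V → V → Prop) : ℕ → Set V
  | 0 => {v | ∀ w, ¬ prec v w}
  | k + 1 => Vcum prec k ∪ {v | v ∉ Vcum prec k ∧ ∀ w, w ∉ Vcum prec k → ¬ prec v w}

/-- `Vlayer prec k` is `V_k^≺`, the `≺`-maximal elements among the vertices not of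
smaller depth. -/
def Vlayer (prec : V → V → Prop) : ℕ → Set V
  | 0 => {v | ∀ w, ¬ prec v w}
  | k + 1 => {v | v ∉ Vcum prec k ∧ ∀ w, w ∉ Vcum prec k → ¬ prec v w}

/-- `prec` is more delayed than `prec'`. -/
def MoreDelayed (prec prec' : V → V → Prop) : Prop :=
  (∀ k, (Vcum prec' k).ncard ≤ (Vcum prec k).ncard) ∧
  ∃ k, (Vcum prec' k).ncard < (Vcum prec k).ncard

/-- A maximally delayed Pauli flow: no Pauli flow for the same labelled open graph is
more delayed. -/
def IsMaxDelayed (Γ : LOG V) (p : V → Set V) (prec : V → V → Prop) : Prop :=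
  IsPauliFlow Γ p prec ∧
  ∀ q prec', IsPauliFlow Γ q prec' → ¬ MoreDelayed prec' prec

/-- `Λ_u^P`: the measured vertices other than `u` whose label is `P`. -/
def LamP (Γ : LOG V) (u : V) (P : MeasLabel) : Set V :=
  {v | v ∉ Γ.O ∧ v ≠ u ∧ Γ.lam v = P}

/-- `V_{k+1}^{≺,XY}` where `A = V_{∪k}^≺`. -/
def VXY (Γ : LOG V) (A : Set V) : Set V :=
  {u | u ∉ Γ.O ∧ Γ.lam u ∈ ({MeasLabel.XY, MeasLabel.X, MeasLabel.Y} : Set MeasLabel) ∧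
    ∃ K, K ⊆ (A ∪ LamP Γ u MeasLabel.X ∪ LamP Γ u MeasLabel.Y) ∩ {v | v ∉ Γ.I} ∧
      (K ∩ LamP Γ u MeasLabel.Y) \ A = (odd Γ.G K ∩ LamP Γ u MeasLabel.Y) \ A ∧
      odd Γ.G K \ (A ∪ LamP Γ u MeasLabel.Y ∪ LamP Γ u MeasLabel.Z) = {u}}

/-- `V_{k+1}^{≺,XZ}` where `A = V_{∪k}^≺`. -/
def VXZ (Γ : LOG V) (A : Set V) : Set V :=
  {u | u ∉ Γ.O ∧ Γ.lam u ∈ ({MeasLabel.XZ, MeasLabel.X, MeasLabel.Z} : Set MeasLabel) ∧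
    ∃ K, K ⊆ (A ∪ LamP Γ u MeasLabel.X ∪ LamP Γ u MeasLabel.Y) ∩ {v | v ∉ Γ.I} ∧
      (K ∩ LamP Γ u MeasLabel.Y) \ A = (odd Γ.G (K ∪ {u}) ∩ LamP Γ u MeasLabel.Y) \ A ∧
      odd Γ.G (K ∪ {u}) \ (A ∪ LamP Γ u MeasLabel.Y ∪ LamP Γ u MeasLabel.Z) = {u}}

/-- `V_{k+1}^{≺,YZ}` where `A = V_{∪k}^≺`. -/
def VYZ (Γ : LOG V) (A : Set V) : Set V :=
  {u | u ∉ Γ.O ∧ Γ.lam u ∈ ({MeasLabel.YZ, MeasLabel.Y, MeasLabel.Z} : Set MeasLabel) ∧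
    ∃ K, K ⊆ (A ∪ LamP Γ u MeasLabel.X ∪ LamP Γ u MeasLabel.Y) ∩ {v | v ∉ Γ.I} ∧
      (K ∩ LamP Γ u MeasLabel.Y) \ A = (odd Γ.G (K ∪ {u}) ∩ LamP Γ u MeasLabel.Y) \ A ∧
      odd Γ.G (K ∪ {u}) \ (A ∪ LamP Γ u MeasLabel.Y ∪ LamP Γ u MeasLabel.Z) = ∅}

end LOG


namespace LOG

variable {V : Type} [Fintype V]

theorem mem_odd_symmDiff (G : SimpleGraph V) (A B : Set V) (w : V) :
    w ∈ odd G (symmDiff A B) ↔ ¬ (w ∈ odd G A ↔ w ∈ odd G B) := by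
  classical
  have key : (G.neighborSet w ∩ symmDiff A B).ncard + 2 * (G.neighborSet w ∩ A ∩ B).ncard
      = (G.neighborSet w ∩ A).ncard + (G.neighborSet w ∩ B).ncard := by
    have h1 : ((G.neighborSet w ∩ A) ∪ (G.neighborSet w ∩ B)).ncard
        + ((G.neighborSet w ∩ A) ∩ (G.neighborSet w ∩ B)).ncard
        = (G.neighborSet w ∩ A).ncard + (G.neighborSet w ∩ B).ncard :=
      Set.ncard_union_add_ncard_inter _ _ (Set.toFinite _) (Set.toFinite _)
    have h2 : ((G.neighborSet w ∩ symmDiff A B) ∪ (G.neighborSet w ∩ A ∩ B)).ncard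
        = (G.neighborSet w ∩ symmDiff A B).ncard + (G.neighborSet w ∩ A ∩ B).ncard := by
      apply Set.ncard_union_eq _ (Set.toFinite _) (Set.toFinite _)
      rw [Set.disjoint_left]
      intro x
      simp only [Set.mem_inter_iff, Set.mem_symmDiff]
      tauto
    have h3 : (G.neighborSet w ∩ A) ∪ (G.neighborSet w ∩ B)
        = (G.neighborSet w ∩ symmDiff A B) ∪ (G.neighborSet w ∩ A ∩ B) := by
      ext x
      simp only [Set.mem_inter_iff, Set.mem_union, Set.mem_symmDiff]
      tauto
    have h4 : (G.neighborSet w ∩ A) ∩ (G.neighborSet w ∩ B) = G.neighborSet w ∩ A ∩ B := by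
      ext x
      simp only [Set.mem_inter_iff]
      tauto
    rw [h3, h2, h4] at h1
    omega
  simp only [odd, Set.mem_ofPred_eq, Nat.odd_iff]
  omega

/-- `A` violates the focussing condition at `w`. -/
def viol (Γ : LOG V) (A : Set V) (w : V) : Prop :=
  match Γ.lam w with
  | .XY => w ∈ odd Γ.G A
  | .X => w ∈ odd Γ.G A
  | .XZ => w ∈ A
  | .YZ => w ∈ A
  | .Z => w ∈ A
  | .Y => ¬ (w ∈ A ↔ w ∈ odd Γ.G A)

theorem viol_symmDiff (Γ : LOG V) (A B : Set V) (w : V) :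
    viol Γ (symmDiff A B) w ↔ ¬ (viol Γ A w ↔ viol Γ B w) := by
  unfold viol
  cases Γ.lam w <;> simp only [mem_odd_symmDiff, Set.mem_symmDiff] <;> tauto

theorem viol_self {Γ : LOG V} {p : V → Set V} {prec : V → V → Prop}
    (h : IsPauliFlow Γ p prec) {w : V} (hw : w ∉ Γ.O) : viol Γ (p w) w := by
  have h4 := h.pf4 w hw
  have h5 := h.pf5 w hw
  have h6 := h.pf6 w hw
  have h7 := h.pf7 w hw
  have h8 := h.pf8 w hw
  have h9 := h.pf9 w hw
  unfold viol
  cases hl : Γ.lam w <;> simp only [hl, true_implies, reduceCtorEq] at * <;> tauto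

theorem viol_prec {Γ : LOG V} {p : V → Set V} {prec : V → V → Prop}
    (h : IsPauliFlow Γ p prec) {u w : V} (hu : u ∉ Γ.O) (hw : w ∉ Γ.O) (hne : u ≠ w)
    (hv : viol Γ (p u) w) : prec u w := by
  have h1 := h.pf1 u hu w
  have h2 := h.pf2 u hu w
  have h3 := h.pf3 u hu w
  unfold viol at hv
  cases hl : Γ.lam w <;> simp [labIn, hl] at * <;> tauto

theorem focussed_of_not_viol {Γ : LOG V} {A S : Set V} (h : ∀ w ∈ S, ¬ viol Γ A w) :
    FocussedOver Γ A S := by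
  refine ⟨?_, ?_, ?_⟩
  · rintro w ⟨hw, hA⟩
    have := h w hw
    unfold viol at this
    cases hl : Γ.lam w <;> simp [hl] at * <;> tauto
  · rintro w ⟨hw, hA⟩
    have := h w hw
    unfold viol at this
    cases hl : Γ.lam w <;> simp [hl] at * <;> tauto
  · intro w hw hl
    have := h w hw
    unfold viol at this
    simp only [hl] at this
    tauto

open Classical in
theorem flow_update {Γ : LOG V} {p : V → Set V} {prec : V → V → Prop}
    (h : IsPauliFlow Γ p prec) {v w : V} (hv : v ∉ Γ.O) (hw : w ∉ Γ.O) (hvw : prec v w) :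
    IsPauliFlow Γ (Function.update p v (symmDiff (p v) (p w))) prec := by
  have hne : w ≠ v := fun e => h.irrefl v (e ▸ hvw)
  have hnp : ¬ prec w v := fun e => h.irrefl v (h.trans _ _ _ hvw e)
  have a1 : ¬ Γ.labIn v {MeasLabel.X, MeasLabel.Y} → v ∉ p w :=
    fun hl hm => hnp (h.pf1 w hw v hm hne hl)
  have a2 : ¬ Γ.labIn v {MeasLabel.Y, MeasLabel.Z} → v ∉ odd Γ.G (p w) :=
    fun hl hm => hnp (h.pf2 w hw v hm hne hl)
  have a3 := h.pf3 w hw v hnp hne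
  constructor
  · exact h.irrefl
  · exact h.trans
  · intro u hu
    by_cases e : u = v
    · subst e
      rw [Function.update_self]
      rintro x (hx | hx)
      · exact h.psub u hu x hx.1
      · exact h.psub w hw x hx.1
    · rw [Function.update_of_ne e]; exact h.psub u hu
  · intro u hu
    by_cases e : u = v
    · subst e
      rw [Function.update_self]
      rintro x (hx | hx) hux hl
      · exact h.pf1 u hu x hx.1 hux hl
      · by_cases ex : w = x
        · exact ex ▸ hvw
        · exact h.trans _ _ _ hvw (h.pf1 w hw x hx.1 ex hl)
    · rw [Function.update_of_ne e]; exact h.pf1 u hu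
  · intro u hu
    by_cases e : u = v
    · subst e
      rw [Function.update_self]
      intro x hx hux hl
      rw [mem_odd_symmDiff] at hx
      by_cases hxu : x ∈ odd Γ.G (p u)
      · exact h.pf2 u hu x hxu hux hl
      · by_cases ex : w = x
        · exact ex ▸ hvw
        · exact h.trans _ _ _ hvw (h.pf2 w hw x (by tauto) ex hl)
    · rw [Function.update_of_ne e]; exact h.pf2 u hu
  · intro u hu
    by_cases e : u = v
    · subst e
      rw [Function.update_self]
      intro x hx hux hl
      have b1 := h.pf3 u hu x hx hux hl
      have b2 := h.pf3 w hw x (fun e => hx (h.trans _ _ _ hvw e)) (fun e => hx (e ▸ hvw)) hl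
      rw [mem_odd_symmDiff, Set.mem_symmDiff]
      tauto
    · rw [Function.update_of_ne e]; exact h.pf3 u hu
  · intro u hu
    by_cases e : u = v
    · subst e
      rw [Function.update_self]
      intro hl
      have c := h.pf4 u hu hl
      have d1 := a1 (by simp [labIn, hl])
      have d2 := a2 (by simp [labIn, hl])
      simp only [mem_odd_symmDiff, Set.mem_symmDiff]
      clear a1 a2 a3
      tauto
    · rw [Function.update_of_ne e]; exact h.pf4 u hu
  · intro u hu
    by_cases e : u = v
    · subst e
      rw [Function.update_self]
      intro hl
      have c := h.pf5 u hu hl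
      have d1 := a1 (by simp [labIn, hl])
      have d2 := a2 (by simp [labIn, hl])
      simp only [mem_odd_symmDiff, Set.mem_symmDiff]
      clear a1 a2 a3
      tauto
    · rw [Function.update_of_ne e]; exact h.pf5 u hu
  · intro u hu
    by_cases e : u = v
    · subst e
      rw [Function.update_self]
      intro hl
      have c := h.pf6 u hu hl
      have d1 := a1 (by simp [labIn, hl])
      have d2 := a2 (by simp [labIn, hl])
      simp only [mem_odd_symmDiff, Set.mem_symmDiff]
      clear a1 a2 a3
      tauto
    · rw [Function.update_of_ne e]; exact h.pf6 u hu
  · intro u hu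
    by_cases e : u = v
    · subst e
      rw [Function.update_self]
      intro hl
      have c := h.pf7 u hu hl
      have d2 := a2 (by simp [labIn, hl])
      simp only [mem_odd_symmDiff, Set.mem_symmDiff]
      clear a1 a2 a3
      tauto
    · rw [Function.update_of_ne e]; exact h.pf7 u hu
  · intro u hu
    by_cases e : u = v
    · subst e
      rw [Function.update_self]
      intro hl
      have c := h.pf8 u hu hl
      have d1 := a1 (by simp [labIn, hl])
      simp only [mem_odd_symmDiff, Set.mem_symmDiff]
      clear a1 a2 a3
      tauto
    · rw [Function.update_of_ne e]; exact h.pf8 u hu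
  · intro u hu
    by_cases e : u = v
    · subst e
      rw [Function.update_self]
      intro hl
      have c := h.pf9 u hu hl
      have d3 := a3 (by simp [labIn, hl, hu])
      simp only [mem_odd_symmDiff, Set.mem_symmDiff]
      clear a1 a2 a3
      tauto
    · rw [Function.update_of_ne e]; exact h.pf9 u hu

/-- Measured vertices other than `v` where `A` is not focussed. -/
def bad (Γ : LOG V) (v : V) (A : Set V) : Set V :=
  {w | w ∉ Γ.O ∧ w ≠ v ∧ viol Γ A w}

/-- Upward closure of the bad vertices. -/
def upBad (Γ : LOG V) (prec : V → V → Prop) (v : V) (A : Set V) : Set V :=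
  {x | ∃ b ∈ bad Γ v A, b = x ∨ prec b x}

theorem focus_aux (Γ : LOG V) (prec : V → V → Prop) (v : V) (hv : v ∉ Γ.O) (n : ℕ) :
    ∀ p : V → Set V, IsPauliFlow Γ p prec → (upBad Γ prec v (p v)).ncard = n →
    ∃ p' : V → Set V, (∀ w, w ∉ Γ.O → w ≠ v → p' w = p w) ∧
      FocussedOver Γ (p' v) ({w | w ∉ Γ.O} \ {v}) ∧ IsPauliFlow Γ p' prec := by
  classical
  induction n using Nat.strong_induction_on with
  | _ n ih =>
  intro p h hn
  by_cases hb : (bad Γ v (p v)).Nonempty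
  · have : IsTrans V prec := ⟨h.trans⟩
    have : Std.Irrefl prec := ⟨h.irrefl⟩
    have wf : WellFounded prec := Finite.wellFounded_of_trans_of_irrefl prec
    obtain ⟨w, ⟨hwO, hwv, hwb⟩, hmin⟩ := wf.has_min _ hb
    have hvw : prec v w := viol_prec h hv hwO (Ne.symm hwv) hwb
    have hnew : ∀ b ∈ bad Γ v (symmDiff (p v) (p w)),
        b ≠ w ∧ (b ∈ bad Γ v (p v) ∨ prec w b) := by
      rintro b ⟨hbO, hbv, hbb⟩
      rw [viol_symmDiff] at hbb
      have hbw : b ≠ w := by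
        rintro rfl
        have := viol_self h hbO
        tauto
      refine ⟨hbw, ?_⟩
      by_cases hp : viol Γ (p v) b
      · exact Or.inl ⟨hbO, hbv, hp⟩
      · exact Or.inr (viol_prec h hwO hbO (Ne.symm hbw) (by tauto))
    have hlt : (upBad Γ prec v (symmDiff (p v) (p w))).ncard < n := by
      rw [← hn]
      apply Set.ncard_lt_ncard _ (Set.toFinite _)
      rw [Set.ssubset_iff_of_subset]
      · refine ⟨w, ⟨w, ⟨hwO, hwv, hwb⟩, Or.inl rfl⟩, ?_⟩
        rintro ⟨b, hbb, hx⟩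
        obtain ⟨h1, h2⟩ := hnew b hbb
        rcases hx with hx | hx
        · exact h1 hx
        · rcases h2 with h2 | h2
          · exact hmin b h2 hx
          · exact h.irrefl _ (h.trans _ _ _ h2 hx)
      · rintro x ⟨b, hbb, hx⟩
        obtain ⟨h1, h2 | h2⟩ := hnew b hbb
        · exact ⟨b, h2, hx⟩
        · refine ⟨w, ⟨hwO, hwv, hwb⟩, Or.inr ?_⟩
          rcases hx with hx | hx
          · exact hx ▸ h2
          · exact h.trans _ _ _ h2 hx
    obtain ⟨p', h1, h2, h3⟩ := ih _ hlt _ (flow_update h hv hwO hvw)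
      (by rw [Function.update_self])
    refine ⟨p', fun u hu huv => ?_, h2, h3⟩
    rw [h1 u hu huv, Function.update_of_ne huv]
  · refine ⟨p, fun _ _ _ => rfl, focussed_of_not_viol ?_, h⟩
    rintro w ⟨hw, hwv⟩ hviol
    exact hb ⟨w, hw, hwv, hviol⟩

end LOG

open LOG in
/-- any single correction set of a Pauli flow can be replaced by one that
is focussed over the other measured vertices, keeping a Pauli flow. -/
theorem focus_single_correction_set {V : Type} [Fintype V] (Γ : LOG V)
    (p : V → Set V) (prec : V → V → Prop) (hpf : IsPauliFlow Γ p prec)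
    (v : V) (hv : v ∉ Γ.O) :
    ∃ p' : V → Set V,
      (∀ w, w ∉ Γ.O → w ≠ v → p' w = p w) ∧
      FocussedOver Γ (p' v) ({w | w ∉ Γ.O} \ {v}) ∧
      IsPauliFlow Γ p' prec := by
  exact LOG.focus_aux Γ prec v hv _ p hpf rfl
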